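/- arXiv:2605.12890 — 5 statements merged into one kernel-verified Lean document; each statement's English description precedes it below -/
import Mathlib

section
/- Let P0 and P1 be probability measures on a measurable space X with P1 absolutely continuous with respect to P0, let L := dP1/dP0 be a version of the Radon–Nikodym derivative with L(x) > 0 for P0-almost every x, and let S(x) := log L(x). Let α ∈ (0,1) and let τ* ∈ ℝ satisfy P0({x : S(x) ≥ τ*}) = α. Let Ŝ : X → ℝ be measurable and τ̂ ∈ ℝ. Define R* := {x : S(x) < τ*} and R̂ := {x : Ŝ(x) < τ̂}, and let R̂ Δ R* := (R̂ \ R*) ∪ (R* \ R̂). Then P1(R̂) − P1(R*) = ∫_{R̂ Δ R*} |L(x) − e^{τ*}| dP0(x) + e^{τ*}·(α − P0(X \ R̂)). -/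
open MeasureTheory

/-- Exact decomposition of the excess Type-II error of a plug-in detector relative
to the oracle likelihood-ratio test. -/
theorem stmt2 {X : Type*} [MeasurableSpace X]
    (P0 P1 : Measure X) [IsProbabilityMeasure P0] [IsProbabilityMeasure P1]
    (hac : P1 ≪ P0)
    (L : X → ℝ) (hL : Measurable L) (hLpos : ∀ᵐ x ∂P0, 0 < L x)
    (hdens : ∀ A : Set X, MeasurableSet A → (P1 A).toReal = ∫ x in A, L x ∂P0)
    (α : ℝ) (hα : α ∈ Set.Ioo (0:ℝ) 1)
    (τstar : ℝ) (hτ : (P0 {x | τstar ≤ Real.log (L x)}).toReal = α)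
    (Shat : X → ℝ) (hShat : Measurable Shat) (τhat : ℝ) :
    (P1 {x | Shat x < τhat}).toReal - (P1 {x | Real.log (L x) < τstar}).toReal =
      (∫ x in (({x | Shat x < τhat} \ {x | Real.log (L x) < τstar}) ∪
               ({x | Real.log (L x) < τstar} \ {x | Shat x < τhat})),
          |L x - Real.exp τstar| ∂P0)
      + Real.exp τstar * (α - (P0 (Set.univ \ {x | Shat x < τhat})).toReal) := by
  have hint : Integrable L P0 := by
    by_contra h
    have h1 := hdens Set.univ MeasurableSet.univ
    rw [Measure.restrict_univ, integral_undef h] at h1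
    simp at h1
  set c := Real.exp τstar with hc
  set A : Set X := {x | Shat x < τhat} with hA
  set B : Set X := {x | Real.log (L x) < τstar} with hB
  have mA : MeasurableSet A := measurableSet_lt hShat measurable_const
  have mB : MeasurableSet B := measurableSet_lt (Real.measurable_log.comp hL) measurable_const
  have hBc : {x | τstar ≤ Real.log (L x)} = Bᶜ := by
    ext x; simp [hB]
  have hi : Integrable (fun x => L x - c) P0 := hint.sub (integrable_const c)
  have key : ∀ T : Set X, MeasurableSet T →
      ∫ x, T.indicator (fun x => L x - c) x ∂P0 = (P1 T).toReal - c * (P0 T).toReal := by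
    intro T mT
    rw [integral_indicator mT, integral_sub hint.integrableOn (integrable_const c).integrableOn,
      hdens T mT, setIntegral_const, smul_eq_mul, Measure.real, mul_comm]
  have main : ∫ x in (A \ B) ∪ (B \ A), |L x - c| ∂P0 =
      ∫ x, (A.indicator (fun x => L x - c) x - B.indicator (fun x => L x - c) x) ∂P0 := by
    rw [← integral_indicator ((mA.diff mB).union (mB.diff mA))]
    apply integral_congr_ae
    filter_upwards [hLpos] with x hx
    have hb : x ∈ B ↔ L x < c := by
      rw [hB, hc]; exact Real.log_lt_iff_lt_exp hx
    by_cases h1 : x ∈ A <;> by_cases h2 : x ∈ B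
    · simp [h1, h2]
    · have : 0 ≤ L x - c := by
        rw [hb] at h2; linarith
      simp [h1, h2, abs_of_nonneg this]
    · have : L x - c ≤ 0 := by
        have := hb.1 h2; linarith
      simp [h1, h2, abs_of_nonpos this]
    · simp [h1, h2]
  have compl : ∀ T : Set X, MeasurableSet T → (P0 Tᶜ).toReal = 1 - (P0 T).toReal := by
    intro T mT
    exact probReal_compl_eq_one_sub mT
  rw [main, integral_sub (hi.indicator mA) (hi.indicator mB), key A mA, key B mB,
    ← Set.compl_eq_univ_diff, compl A mA, ← hτ, hBc, compl B mB]
  ring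
end

section
/- Let P0 be a probability measure on a measurable space X, let S, Ŝ : X → ℝ be measurable with sup_{x∈X} |Ŝ(x) − S(x)| ≤ r for some r ≥ 0, let α ∈ (0,1), and let τ* ∈ ℝ satisfy P0({x : S(x) ≥ τ*}) = α. Let τ̂ ∈ ℝ and Δ > 0 satisfy |P0({x : Ŝ(x) ≥ τ̂}) − α| ≤ Δ. Suppose there exist constants c0 > 0, γ > 0 and ε0 > 0 such that for every ε ∈ [0, ε0], P0({x : τ* ≤ S(x) < τ* + ε}) ≥ c0·ε^γ and P0({x : τ* − ε ≤ S(x) < τ*}) ≥ c0·ε^γ, and suppose (Δ/c0)^{1/γ} < ε0. Then |τ̂ − τ*| ≤ r + (Δ/c0)^{1/γ}. -/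
open MeasureTheory

/-- Deviation of the calibrated threshold from the oracle threshold under a uniform
score error bound and one-sided local-mass lower bounds around the oracle threshold. -/
theorem stmt3 {X : Type*} [MeasurableSpace X]
    (P0 : Measure X) [IsProbabilityMeasure P0]
    (S Shat : X → ℝ) (hS : Measurable S) (hShat : Measurable Shat)
    (r : ℝ) (hr : 0 ≤ r) (hunif : ∀ x, |Shat x - S x| ≤ r)
    (α : ℝ) (hα : α ∈ Set.Ioo (0:ℝ) 1)
    (τstar : ℝ) (hτ : (P0 {x | τstar ≤ S x}).toReal = α)
    (τhat Δ : ℝ) (hΔ : 0 < Δ)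
    (hcal : |(P0 {x | τhat ≤ Shat x}).toReal - α| ≤ Δ)
    (c0 γ ε0 : ℝ) (hc0 : 0 < c0) (hγ : 0 < γ) (hε0 : 0 < ε0)
    (hlow1 : ∀ ε ∈ Set.Icc (0:ℝ) ε0,
      c0 * ε ^ γ ≤ (P0 {x | τstar ≤ S x ∧ S x < τstar + ε}).toReal)
    (hlow2 : ∀ ε ∈ Set.Icc (0:ℝ) ε0,
      c0 * ε ^ γ ≤ (P0 {x | τstar - ε ≤ S x ∧ S x < τstar}).toReal)
    (hsmall : (Δ / c0) ^ (1 / γ) < ε0) :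
    |τhat - τstar| ≤ r + (Δ / c0) ^ (1 / γ) := by
  have key : ∀ ε, (Δ / c0) ^ (1 / γ) < ε → Δ < c0 * ε ^ γ := by
    intro ε h
    have hq : 0 < Δ / c0 := div_pos hΔ hc0
    have h1 : ((Δ / c0) ^ (1 / γ)) ^ γ < ε ^ γ :=
      Real.rpow_lt_rpow (Real.rpow_nonneg hq.le _) h hγ
    rw [← Real.rpow_mul hq.le, one_div_mul_cancel hγ.ne', Real.rpow_one, div_lt_iff₀ hc0] at h1
    linarith
  have he : 0 ≤ (Δ / c0) ^ (1 / γ) := Real.rpow_nonneg (div_pos hΔ hc0).le _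
  have addle : ∀ A B C : Set X, MeasurableSet B → Disjoint A B → A ⊆ C → B ⊆ C →
      (P0 A).toReal + (P0 B).toReal ≤ (P0 C).toReal := by
    intro A B C hB hd hA hBC
    rw [← ENNReal.toReal_add (measure_ne_top _ _) (measure_ne_top _ _), ← measure_union hd hB]
    exact ENNReal.toReal_mono (measure_ne_top _ _) (measure_mono (Set.union_subset hA hBC))
  have hcal' := abs_le.1 hcal
  generalize (Δ / c0) ^ (1 / γ) = e at *
  rw [abs_le]
  constructor
  · by_contra! hlt
    have h1 : e < min (τstar - τhat - r) ε0 := lt_min (by linarith) hsmall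
    have h2 := min_le_left (τstar - τhat - r) ε0
    have h3 := min_le_right (τstar - τhat - r) ε0
    generalize min (τstar - τhat - r) ε0 = ε at *
    have h4 := hlow2 ε ⟨by linarith, h3⟩
    have h5 := key ε h1
    have h6 := addle {x | τstar - ε ≤ S x ∧ S x < τstar} {x | τstar ≤ S x} {x | τhat ≤ Shat x}
      (measurableSet_le measurable_const hS)
      (Set.disjoint_left.2 fun x hx hy => not_lt.2 hy hx.2)
      (fun x hx => by
        have := abs_le.1 (hunif x)
        have := hx.1
        simp only [Set.mem_setOf_eq]; linarith)
      (fun x hx => by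
        have := abs_le.1 (hunif x)
        simp only [Set.mem_setOf_eq] at hx ⊢; linarith)
    linarith [hcal'.2]
  · by_contra! hlt
    have h1 : e < min (τhat - τstar - r) ε0 := lt_min (by linarith) hsmall
    have h2 := min_le_left (τhat - τstar - r) ε0
    have h3 := min_le_right (τhat - τstar - r) ε0
    generalize min (τhat - τstar - r) ε0 = ε at *
    have h4 := hlow1 ε ⟨by linarith, h3⟩
    have h5 := key ε h1
    have h6 := addle {x | τstar ≤ S x ∧ S x < τstar + ε} {x | τhat ≤ Shat x} {x | τstar ≤ S x}
      (measurableSet_le measurable_const hShat)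
      (Set.disjoint_left.2 fun x hx hy => by
        have := abs_le.1 (hunif x)
        have := hx.2
        simp only [Set.mem_setOf_eq] at hy; linarith)
      (fun x hx => hx.1)
      (fun x hx => by
        have := abs_le.1 (hunif x)
        simp only [Set.mem_setOf_eq] at hx ⊢; linarith)
    linarith [hcal'.1]
end

section
/- Let P0 and P1 be probability measures on a measurable space X with P1 absolutely continuous with respect to P0 and density dP1/dP0 = e^S for a measurable S : X → ℝ satisfying |S(x)| ≤ 2κ for all x, where κ > 0. Let α ∈ (0,1) and τ* ∈ [−2κ, 2κ] satisfy P0({x : S(x) ≥ τ*}) = α. Let Ŝ : X → ℝ be measurable with sup_{x∈X} |Ŝ(x) − S(x)| ≤ r, and let τ̂ ∈ ℝ, Δ ≥ 0, u ≥ 0 satisfy |P0({x : Ŝ(x) ≥ τ̂}) − α| ≤ Δ and |τ̂ − τ*| ≤ r + u. Suppose there exist C0 > 0, γ̄ > 0 and ε0 > 0 such that P0({x : |S(x) − τ*| ≤ ε}) ≤ C0·ε^{γ̄} for every ε ∈ [0, ε0], and 2r + u ≤ ε0. Define R* := {x : S(x) < τ*} and R̂ := {x : Ŝ(x) < τ̂}.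 Then P1(R̂) − P1(R*) ≤ e^{2κ}·C0·(2r + u)^{1+γ̄} + e^{τ*}·Δ. -/
open MeasureTheory

theorem exp_sub_aux (a b M : ℝ) (ha : a ≤ M) (hab : b ≤ a) :
    Real.exp a - Real.exp b ≤ Real.exp M * (a - b) := by
  have h1 := Real.add_one_le_exp (b - a)
  have h2 : Real.exp b = Real.exp a * Real.exp (b - a) := by
    rw [← Real.exp_add]; congr 1; ring
  have h3 : Real.exp a ≤ Real.exp M := Real.exp_le_exp.mpr ha
  have h4 := Real.exp_pos a
  rw [h2]
  nlinarith

/-- Deterministic core of the excess Type-II error bound: estimation error of order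
`(2r+u)^(1+γ̄)` plus calibration error `e^{τ*}·Δ`. -/
theorem stmt5 {X : Type*} [MeasurableSpace X]
    (P0 P1 : Measure X) [IsProbabilityMeasure P0] [IsProbabilityMeasure P1]
    (hac : P1 ≪ P0)
    (S : X → ℝ) (hS : Measurable S) (κ : ℝ) (hκ : 0 < κ)
    (hbound : ∀ x, |S x| ≤ 2 * κ)
    (hdens : ∀ A : Set X, MeasurableSet A → (P1 A).toReal = ∫ x in A, Real.exp (S x) ∂P0)
    (α : ℝ) (hα : α ∈ Set.Ioo (0:ℝ) 1)
    (τstar : ℝ) (hτrange : τstar ∈ Set.Icc (-(2 * κ)) (2 * κ))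
    (hτ : (P0 {x | τstar ≤ S x}).toReal = α)
    (Shat : X → ℝ) (hShat : Measurable Shat)
    (r : ℝ) (hunif : ∀ x, |Shat x - S x| ≤ r)
    (τhat Δ u : ℝ) (hΔ : 0 ≤ Δ) (hu : 0 ≤ u)
    (hcal : |(P0 {x | τhat ≤ Shat x}).toReal - α| ≤ Δ)
    (hclose : |τhat - τstar| ≤ r + u)
    (C0 γbar ε0 : ℝ) (hC0 : 0 < C0) (hγ : 0 < γbar) (hε0 : 0 < ε0)
    (hup : ∀ ε ∈ Set.Icc (0:ℝ) ε0,
      (P0 {x | |S x - τstar| ≤ ε}).toReal ≤ C0 * ε ^ γbar)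
    (hsmall : 2 * r + u ≤ ε0) :
    (P1 {x | Shat x < τhat}).toReal - (P1 {x | S x < τstar}).toReal ≤
      Real.exp (2 * κ) * C0 * (2 * r + u) ^ (1 + γbar) + Real.exp τstar * Δ := by
  obtain ⟨x0⟩ : Nonempty X := P0.nonempty_of_neZero
  have hr : 0 ≤ r := (abs_nonneg _).trans (hunif x0)
  set δ := 2 * r + u with hδ
  have hδ0 : 0 ≤ δ := by positivity
  have mA : MeasurableSet {x | Shat x < τhat} := measurableSet_lt hShat measurable_const
  have mB : MeasurableSet {x | S x < τstar} := measurableSet_lt hS measurable_const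
  have mD : MeasurableSet {x | |S x - τstar| ≤ δ} :=
    measurableSet_le (by fun_prop) measurable_const
  have iE : Integrable (fun x => Real.exp (S x)) P0 := by
    refine Integrable.of_bound (C := Real.exp (2 * κ)) (by fun_prop) ?_
    refine Filter.Eventually.of_forall fun x => ?_
    rw [Real.norm_eq_abs, abs_of_pos (Real.exp_pos _)]
    exact Real.exp_le_exp.mpr ((le_abs_self _).trans (hbound x))
  have hcA : P0.real {x | τhat ≤ Shat x} = 1 - P0.real {x | Shat x < τhat} := by
    rw [← probReal_compl_eq_one_sub mA]
    congr 1; ext x; simp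
  have hcB : P0.real {x | τstar ≤ S x} = 1 - P0.real {x | S x < τstar} := by
    rw [← probReal_compl_eq_one_sub mB]
    congr 1; ext x; simp
  have hcal2 : P0.real {x | Shat x < τhat} - P0.real {x | S x < τstar} ≤ Δ := by
    have h1 := (abs_le.mp hcal).1
    change -Δ ≤ P0.real {x | τhat ≤ Shat x} - α at h1
    change P0.real {x | τstar ≤ S x} = α at hτ
    linarith
  have hD : P0.real {x | |S x - τstar| ≤ δ} ≤ C0 * δ ^ γbar := hup δ ⟨hδ0, hsmall⟩
  have key : ∫ x, ({x | Shat x < τhat}.indicator (fun x => Real.exp (S x)) x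
        - {x | S x < τstar}.indicator (fun x => Real.exp (S x)) x) ∂P0 ≤
      ∫ x, ({x | |S x - τstar| ≤ δ}.indicator (fun _ => Real.exp (2 * κ) * δ) x
        + ({x | Shat x < τhat}.indicator (fun _ => Real.exp τstar) x
        - {x | S x < τstar}.indicator (fun _ => Real.exp τstar) x)) ∂P0 := by
    refine integral_mono ((iE.indicator mA).sub (iE.indicator mB))
      (((integrable_const _).indicator mD).add
        (((integrable_const _).indicator mA).sub ((integrable_const _).indicator mB))) ?_
    intro x
    have hx := abs_le.mp (hunif x)
    have hc := abs_le.mp hclose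
    have hSx : S x ≤ 2 * κ := (le_abs_self _).trans (hbound x)
    have hE := Real.exp_pos (2 * κ)
    have hEδ : 0 ≤ Real.exp (2 * κ) * δ := by positivity
    have hDn : 0 ≤ {x | |S x - τstar| ≤ δ}.indicator (fun _ => Real.exp (2 * κ) * δ) x :=
      Set.indicator_nonneg (fun _ _ => hEδ) x
    by_cases hA : Shat x < τhat <;> by_cases hB : S x < τstar
    · simp only [Set.indicator, Set.mem_ofPred_eq, hA, hB, if_true] at hDn ⊢
      linarith
    · have hm : |S x - τstar| ≤ δ := abs_le.mpr ⟨by linarith, by linarith⟩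
      simp only [Set.indicator, Set.mem_ofPred_eq, hA, hB, hm, if_true, if_false]
      have h1 := exp_sub_aux (S x) τstar (2 * κ) hSx (not_lt.mp hB)
      have h2 := mul_le_mul_of_nonneg_left (abs_le.mp hm).2 hE.le
      linarith
    · have hm : |S x - τstar| ≤ δ := abs_le.mpr ⟨by linarith, by linarith⟩
      simp only [Set.indicator, Set.mem_ofPred_eq, hA, hB, hm, if_true, if_false]
      have h1 := exp_sub_aux τstar (S x) (2 * κ) hτrange.2 hB.le
      have h2 := mul_le_mul_of_nonneg_left (abs_le.mp hm).1 hE.le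
      linarith
    · simp only [Set.indicator, Set.mem_ofPred_eq, hA, hB, if_false] at hDn ⊢
      linarith
  have iAB : Integrable (fun x => {x | Shat x < τhat}.indicator (fun _ => Real.exp τstar) x
        - {x | S x < τstar}.indicator (fun _ => Real.exp τstar) x) P0 :=
    ((integrable_const _).indicator mA).sub ((integrable_const _).indicator mB)
  rw [integral_sub (iE.indicator mA) (iE.indicator mB),
    integral_add ((integrable_const _).indicator mD) iAB,
    integral_sub ((integrable_const _).indicator mA) ((integrable_const _).indicator mB),
    integral_indicator mA, integral_indicator mB, integral_indicator_const _ mA,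
    integral_indicator_const _ mB, integral_indicator_const _ mD,
    ← hdens _ mA, ← hdens _ mB] at key
  simp only [smul_eq_mul] at key
  have hpow : δ ^ (1 + γbar) = δ * δ ^ γbar := by
    rw [Real.rpow_add_of_nonneg hδ0 zero_le_one hγ.le, Real.rpow_one]
  rw [hpow]
  have h1 := mul_le_mul_of_nonneg_left hD (mul_nonneg (Real.exp_pos (2 * κ)).le hδ0)
  have h2 := mul_le_mul_of_nonneg_left hcal2 (Real.exp_pos τstar).le
  linarith
end

section
/- Let H be a real inner product space and let A > 0. There exist constants c0 ∈ (0,1) and ρ0 ∈ (0,1), depending only on A, such that for every ρ ∈ (0, ρ0] and all unit vectors u, μ ∈ H with ‖u − μ‖ ≤ 1/4, the vector (1 − ρ)u + ρ·A·μ is nonzero and ‖Π((1 − ρ)u + ρ·A·μ) − μ‖ ≤ (1 − c0·ρ)·‖u − μ‖, where Π(x) = x/‖x‖. -/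
/-- Local contraction of the EMA-with-projection step toward an attenuated target:
mixing a unit vector `u` with `A·μ` (weight `ρ`) and renormalizing strictly contracts
the distance to the unit vector `μ`, provided `‖u − μ‖ ≤ 1/4`. -/
theorem stmt7 {H : Type*} [NormedAddCommGroup H] [InnerProductSpace ℝ H]
    (A : ℝ) (hA : 0 < A) :
    ∃ c0 ∈ Set.Ioo (0:ℝ) 1, ∃ ρ0 ∈ Set.Ioo (0:ℝ) 1,
      ∀ ρ ∈ Set.Ioc (0:ℝ) ρ0, ∀ u μ : H, ‖u‖ = 1 → ‖μ‖ = 1 → ‖u - μ‖ ≤ 1 / 4 →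
        ((1 - ρ) • u + (ρ * A) • μ ≠ 0 ∧
          ‖(‖(1 - ρ) • u + (ρ * A) • μ‖⁻¹) • ((1 - ρ) • u + (ρ * A) • μ) - μ‖
            ≤ (1 - c0 * ρ) * ‖u - μ‖) := by
  have hc1 : A / (2 + A) < 1 := by rw [div_lt_one (by linarith)]; linarith
  have hc0 : 0 < A / (2 + A) := by positivity
  have hcA : A / (2 + A) * (2 + A) = A := by field_simp
  refine ⟨A / (2 + A), ⟨hc0, hc1⟩, 1 / 2, by norm_num, ?_⟩
  generalize A / (2 + A) = c at *
  rintro ρ ⟨hρ, hρ2⟩ u μ hu hμ hd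
  have hd2 : ‖u - μ‖ ^ 2 = 2 - 2 * inner ℝ u μ := by
    rw [norm_sub_sq_real, hu, hμ]; ring
  have ht1 : inner ℝ u μ ≤ 1 := by nlinarith [sq_nonneg ‖u - μ‖]
  have ht2 : 1 / 2 ≤ inner ℝ u μ := by nlinarith [norm_nonneg (u - μ)]
  have hN2 : ‖(1 - ρ) • u + (ρ * A) • μ‖ ^ 2
      = (1 - ρ) ^ 2 + 2 * (1 - ρ) * (ρ * A) * inner ℝ u μ + (ρ * A) ^ 2 := by
    rw [norm_add_sq_real, norm_smul, norm_smul, hu, hμ, real_inner_smul_left,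
      real_inner_smul_right, mul_one, mul_one, Real.norm_eq_abs, Real.norm_eq_abs, sq_abs, sq_abs]
    ring
  have hx : inner ℝ ((1 - ρ) • u + (ρ * A) • μ) μ = (1 - ρ) * inner ℝ u μ + ρ * A := by
    rw [inner_add_left, real_inner_smul_left, real_inner_smul_left, real_inner_self_eq_norm_sq, hμ]
    ring
  have hb : 0 < ρ * A := by positivity
  have hk : 0 < 1 - c * ρ := by nlinarith
  have hkey : 1 - ρ ≤ (1 - c * ρ) * ((1 - ρ) + ρ * A / 2) := by
    have h1 : c * (1 - ρ + ρ * A / 2) ≤ A / 2 := by nlinarith [mul_pos hc0 hA, mul_pos hc0 hρ]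
    nlinarith [mul_le_mul_of_nonneg_left h1 hρ.le]
  have ha : 0 < 1 - ρ := by linarith
  have hk1 : 1 - c * ρ ≤ 1 := by nlinarith
  generalize (1 - ρ) • u + (ρ * A) • μ = x at *
  generalize 1 - c * ρ = k at *
  generalize 1 - ρ = a at *
  generalize ρ * A = b at *
  generalize inner ℝ u μ = t at *
  have hNpos : 0 < ‖x‖ := by
    have : 0 < ‖x‖ ^ 2 := by rw [hN2]; positivity
    exact lt_of_le_of_ne (norm_nonneg x) (fun h => by rw [← h] at this; norm_num at this)
  refine ⟨norm_pos_iff.1 hNpos, ?_⟩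
  have hd' : ‖‖x‖⁻¹ • x - μ‖ ^ 2 = 2 - 2 * (‖x‖⁻¹ * (a * t + b)) := by
    rw [norm_sub_sq_real, norm_smul, norm_inv, norm_norm, inv_mul_cancel₀ hNpos.ne', hμ,
      real_inner_smul_left, hx]; ring
  refine (sq_le_sq₀ (by positivity) (by positivity)).1 ?_
  rw [mul_pow, hd2, hd']
  generalize ‖x‖ = N at *
  have hNa : a + b * t ≤ N := by
    refine (sq_le_sq₀ (by positivity) hNpos.le).1 ?_
    nlinarith [mul_nonneg (sq_nonneg b) (by nlinarith : 0 ≤ 1 - t ^ 2)]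
  have hp : 0 < a * t + b := by positivity
  have h1 : a ≤ k * (a + b * t) := by nlinarith [mul_le_mul_of_nonneg_left ht2 (mul_pos hk hb).le]
  have h2 : a ≤ k * (a + b) := by nlinarith [mul_pos hk hb]
  have h3 : a * a ≤ (k * (a + b * t)) * (k * (a + b)) := mul_le_mul h1 h2 ha.le (by positivity)
  have h4 : (a + b * t) * ((a + b) * (1 + t)) ≤ N * (N + (a * t + b)) :=
    mul_le_mul hNa (by linarith) (by positivity) hNpos.le
  have h5 : a * a * (1 + t) ≤ k ^ 2 * (N * (N + (a * t + b))) := by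
    nlinarith [mul_le_mul_of_nonneg_left h4 (sq_nonneg k), mul_le_mul_of_nonneg_right h3 (by linarith : 0 ≤ 1 + t)]
  have h6 : (N - (a * t + b)) * (N + (a * t + b)) ≤ (k ^ 2 * (1 - t) * N) * (N + (a * t + b)) := by
    have : (N - (a * t + b)) * (N + (a * t + b)) = a * a * (1 + t) * (1 - t) := by
      linear_combination hN2
    rw [this]
    nlinarith [mul_le_mul_of_nonneg_right h5 (by linarith : 0 ≤ 1 - t)]
  have h7 := le_of_mul_le_mul_right h6 (by positivity)
  have h8 : 1 - N⁻¹ * (a * t + b) ≤ k ^ 2 * (1 - t) := by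
    have := mul_le_mul_of_nonneg_left h7 (inv_pos.2 hNpos).le
    have e : N⁻¹ * N = 1 := inv_mul_cancel₀ hNpos.ne'
    linear_combination this + (k ^ 2 * (1 - t) - 1) * e
  linarith
end

section
/- Let (Ω, F, P) be a probability space with filtration (F_t)_{t≥0} and let H be a real inner product space. Fix constants A > 0 and C_μ > 0. There exist constants c ∈ (0,1), C > 0, ρ0 ∈ (0,1), and γ0 > 0 depending only on A and C_μ with the following property. Let T ≥ 1 be an integer, δ ∈ (0,1), ρ ∈ (0, ρ0] with ρ·log(2T/δ) ≤ 1, and η > 0 with η/ρ ≤ γ0. Let (μ_t)_{0≤t≤T} be an (F_t)-adapted H-valued process with ‖μ_t‖ = 1 and ‖μ_{t+1} − μ_t‖ ≤ C_μ·η almost surely for every t; let (ζ_{t+1})_{0≤t≤T−1} be H-valued with ζ_{t+1} F_{t+1}-measurable, E[ζ_{t+1} | F_t] = 0 and ‖ζ_{t+1}‖ ≤ 2 almost surely; let μ̂_0 be an F_0-measurable unit vector satisfying, almost surely, ‖μ̂_0 − μ_0‖ ≤ 1/4 and ‖μ̂_0 − μ_0‖² + C·(√(ρ·log(2T/δ))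 + η²/ρ²) ≤ 1/16; and define recursively z_{t+1} := (1 − ρ)·μ̂_t + ρ·(A·μ_t + ζ_{t+1}) and μ̂_{t+1} := z_{t+1}/‖z_{t+1}‖. Then with probability at least 1 − δ: (i) for all 0 ≤ t ≤ T, ‖μ̂_t − μ_t‖² ≤ (1 − c·ρ)^t·‖μ̂_0 − μ_0‖² + C·(√(ρ·log(2T/δ)) + η²/ρ²); (ii) for all 0 ≤ t ≤ T, ‖μ̂_t − μ_t‖ ≤ 1/4 and ⟨μ̂_t, μ_t⟩ > 0; and (iii) for all 0 ≤ t ≤ T−1, ‖z_{t+1}‖ ≥ 1/4. -/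
open MeasureTheory ProbabilityTheory
open scoped InnerProductSpace

lemma aux_mgf {Ω : Type*} {m0 : MeasurableSpace Ω}
    (P : Measure Ω) [IsProbabilityMeasure P] (ℱ : Filtration ℕ m0)
    {H : Type*} [NormedAddCommGroup H] [InnerProductSpace ℝ H] [CompleteSpace H]
    (ζ u : ℕ → Ω → H) (b : ℕ → ℝ)
    (hζ : ∀ t, StronglyMeasurable[ℱ (t + 1)] (ζ t))
    (hint : ∀ t, Integrable (ζ t) P)
    (hc : ∀ t, P[ζ t | ℱ t] =ᵐ[P] 0)
    (hζb : ∀ t, ∀ᵐ ω ∂P, ‖ζ t ω‖ ≤ 2)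
    (hu : ∀ t, StronglyMeasurable[ℱ t] (u t))
    (hub : ∀ t, ∀ᵐ ω ∂P, ‖u t ω‖ ≤ b t) (hb : ∀ t, 2 * b t ≤ 1) (n : ℕ) :
    StronglyMeasurable[ℱ n] (fun ω => ∑ j ∈ Finset.range n, ⟪u j ω, ζ j ω⟫_ℝ) ∧
    (∀ᵐ ω ∂P, |∑ j ∈ Finset.range n, ⟪u j ω, ζ j ω⟫_ℝ| ≤ n) ∧
    Integrable (fun ω => Real.exp (∑ j ∈ Finset.range n, ⟪u j ω, ζ j ω⟫_ℝ)) P ∧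
    ∫ ω, Real.exp (∑ j ∈ Finset.range n, ⟪u j ω, ζ j ω⟫_ℝ) ∂P
      ≤ Real.exp (∑ j ∈ Finset.range n, 4 * b j ^ 2) := by
  induction n with
  | zero => 
    refine ⟨?_, by simp, by simp, by simp⟩
    simp only [Finset.range_zero, Finset.sum_empty]
    exact stronglyMeasurable_const
  | succ n ih =>
    obtain ⟨h1, h2, h3, h4⟩ := ih
    set S : Ω → ℝ := fun ω => ∑ j ∈ Finset.range n, ⟪u j ω, ζ j ω⟫_ℝ with hS
    have hxb : ∀ᵐ ω ∂P, |⟪u n ω, ζ n ω⟫_ℝ| ≤ 2 * b n := by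
      filter_upwards [hub n, hζb n] with ω ha hb'
      calc |⟪u n ω, ζ n ω⟫_ℝ| ≤ ‖u n ω‖ * ‖ζ n ω‖ := abs_real_inner_le_norm _ _
        _ ≤ b n * 2 := by gcongr; exact (norm_nonneg _).trans ha
        _ = _ := by ring
    have m1 : StronglyMeasurable[ℱ (n+1)]
        (fun ω => ∑ j ∈ Finset.range (n+1), ⟪u j ω, ζ j ω⟫_ℝ) := by
      simp only [Finset.sum_range_succ]
      exact (h1.mono (ℱ.mono (Nat.le_succ n))).add
        (((hu n).mono (ℱ.mono (Nat.le_succ n))).inner (hζ n))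
    have m2 : ∀ᵐ ω ∂P, |∑ j ∈ Finset.range (n+1), ⟪u j ω, ζ j ω⟫_ℝ| ≤ (n+1 : ℕ) := by
      filter_upwards [h2, hxb] with ω ha hb'
      rw [Finset.sum_range_succ]
      push_cast
      have := hb n
      exact (abs_add_le _ _).trans (by linarith)
    have hEb : ∀ᵐ ω ∂P, ‖Real.exp (S ω) • u n ω‖ ≤ Real.exp n * b n := by
      filter_upwards [h2, hub n] with ω ha hb'
      rw [norm_smul, Real.norm_eq_abs, Real.abs_exp]
      gcongr
      exact (le_abs_self _).trans ha
    have hEm : StronglyMeasurable[ℱ n] (fun ω => Real.exp (S ω) • u n ω) :=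
      (Real.continuous_exp.comp_stronglyMeasurable h1).smul (hu n)
    have hpull := condExp_stronglyMeasurable_bilin_of_bound (innerSL ℝ) (ℱ.le n) hEm
      (hint n) _ hEb
    have hzero : ∫ ω, ⟪Real.exp (S ω) • u n ω, ζ n ω⟫_ℝ ∂P = 0 := by
      rw [← integral_condExp (ℱ.le n)]
      rw [← integral_zero Ω ℝ (μ := P)]
      apply integral_congr_ae
      filter_upwards [hpull, hc n] with ω ha hb'
      refine ha.trans ?_
      rw [hb']
      simp
    have hi0 : Integrable (fun ω => ⟪Real.exp (S ω) • u n ω, ζ n ω⟫_ℝ) P := by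
      refine Integrable.of_bound (C := Real.exp n * b n * 2) ?_ ?_
      · exact ((hEm.mono (ℱ.le n)).inner ((hζ n).mono (ℱ.le _))).aestronglyMeasurable
      · filter_upwards [hEb, hζb n] with ω ha hb'
        calc ‖⟪Real.exp (S ω) • u n ω, ζ n ω⟫_ℝ‖ ≤ ‖Real.exp (S ω) • u n ω‖ * ‖ζ n ω‖ :=
              abs_real_inner_le_norm _ _
          _ ≤ _ := by gcongr; exact (norm_nonneg _).trans ha
    have hi1 : Integrable
        (fun ω => Real.exp (∑ j ∈ Finset.range (n+1), ⟪u j ω, ζ j ω⟫_ℝ)) P := by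
      refine Integrable.of_bound (C := Real.exp (n+1 : ℕ)) ?_ ?_
      · exact (Real.continuous_exp.comp_stronglyMeasurable
          (m1.mono (ℱ.le _))).aestronglyMeasurable
      · filter_upwards [m2] with ω ha
        rw [Real.norm_eq_abs, Real.abs_exp]
        exact Real.exp_le_exp.2 ((le_abs_self _).trans ha)
    refine ⟨m1, m2, hi1, ?_⟩
    calc ∫ ω, Real.exp (∑ j ∈ Finset.range (n+1), ⟪u j ω, ζ j ω⟫_ℝ) ∂P
        ≤ ∫ ω, (⟪Real.exp (S ω) • u n ω, ζ n ω⟫_ℝ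
            + Real.exp (4 * b n ^ 2) * Real.exp (S ω)) ∂P := by
          refine integral_mono_ae hi1 (hi0.add (h3.const_mul _)) ?_
          filter_upwards [hxb] with ω ha
          rw [Finset.sum_range_succ, Real.exp_add, real_inner_smul_left]
          change Real.exp (S ω) * _ ≤ _
          set x := ⟪u n ω, ζ n ω⟫_ℝ
          have e1 := (abs_le.1 (Real.abs_exp_sub_one_sub_id_le (ha.trans (hb n)))).2
          have e2 := Real.add_one_le_exp (4 * b n ^ 2)
          have e3 : x ^ 2 ≤ 4 * b n ^ 2 := by
            have := sq_le_sq' (abs_le.1 ha).1 (abs_le.1 ha).2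
            linarith
          have : Real.exp x ≤ x + Real.exp (4 * b n ^ 2) := by linarith
          nlinarith [Real.exp_pos (S ω)]
      _ = Real.exp (4 * b n ^ 2) * ∫ ω, Real.exp (S ω) ∂P := by
          rw [integral_add hi0 (h3.const_mul _), hzero, integral_const_mul, zero_add]
      _ ≤ _ := by
          rw [Finset.sum_range_succ, Real.exp_add, mul_comm]
          gcongr

lemma aux_proj {H : Type*} [NormedAddCommGroup H] [InnerProductSpace ℝ H]
    (h m w : H) (ρ B : ℝ) (hh : ‖h‖ = 1) (hm : ‖m‖ = 1) (hw : ‖w‖ ≤ B) (hρ : 0 < ρ)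
    (hB : ρ * B ≤ 1/4) :
    3/4 ≤ ‖h + ρ • w‖ ∧
    ⟪h, m⟫_ℝ + ρ * (⟪w, m⟫_ℝ - ⟪h, m⟫_ℝ * ⟪w, h⟫_ℝ) - 4 * B^2 * ρ^2
      ≤ ⟪‖h + ρ • w‖⁻¹ • (h + ρ • w), m⟫_ℝ := by
  have hB0 : 0 ≤ B := (norm_nonneg _).trans hw
  have hs : |⟪h, m⟫_ℝ| ≤ 1 := by simpa [hh, hm] using abs_real_inner_le_norm h m
  have hr : |⟪w, m⟫_ℝ| ≤ B := by
    have := abs_real_inner_le_norm w m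
    rw [hm] at this; linarith
  have hp : |⟪w, h⟫_ℝ| ≤ B := by
    have := abs_real_inner_le_norm w h
    rw [hh] at this; linarith
  have hN2 : ‖h + ρ • w‖ ^ 2 = 1 + 2 * (ρ * ⟪w, h⟫_ℝ) + ρ^2 * ‖w‖^2 := by
    rw [norm_add_sq_real, hh, inner_smul_right, norm_smul, real_inner_comm, Real.norm_eq_abs,
      mul_pow, sq_abs]; ring
  have hN1 : |‖h + ρ • w‖ - 1| ≤ ρ * B := by
    have := abs_norm_sub_norm_le (h + ρ • w) h
    rw [hh, add_sub_cancel_left, norm_smul, Real.norm_eq_abs, abs_of_pos hρ] at this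
    exact this.trans (by gcongr)
  have hin : ⟪‖h + ρ • w‖⁻¹ • (h + ρ • w), m⟫_ℝ
      = (⟪h, m⟫_ℝ + ρ * ⟪w, m⟫_ℝ) * ‖h + ρ • w‖⁻¹ := by
    rw [real_inner_smul_left, inner_add_left, real_inner_smul_left]; ring
  rw [hin]
  have hq : ‖w‖^2 ≤ B^2 := by gcongr
  have hq0 : 0 ≤ ‖w‖^2 := by positivity
  generalize ⟪h, m⟫_ℝ = s at *
  generalize ⟪w, m⟫_ℝ = r at *
  generalize ⟪w, h⟫_ℝ = p at *
  generalize ‖h + ρ • w‖ = N at *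
  generalize ‖w‖^2 = q at *
  have hNl : 3/4 ≤ N := by linarith [(abs_le.1 hN1).1]
  refine ⟨hNl, ?_⟩
  have hN0 : 0 < N := by linarith
  set ε := ρ * B with hε
  have hε0 : 0 ≤ ε := by positivity
  have hp' : |ρ * p| ≤ ε := by rw [abs_mul, abs_of_pos hρ]; exact mul_le_mul_of_nonneg_left hp hρ.le
  have hr' : |ρ * r| ≤ ε := by rw [abs_mul, abs_of_pos hρ]; exact mul_le_mul_of_nonneg_left hr hρ.le
  have hNsq : (N - 1)^2 ≤ ε^2 := sq_le_sq' (by linarith [(abs_le.1 hN1).1]) (abs_le.1 hN1).2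
  have hqq : ρ^2 * q ≤ ε^2 := by rw [hε, mul_pow]; gcongr
  have hqq0 : 0 ≤ ρ^2 * q := by positivity
  have hd : |1 + ρ * p - N| ≤ ε^2/2 := by
    rw [abs_le]; constructor <;> nlinarith
  have hpn : |ρ * p * (N - 1)| ≤ ε^2 := by
    rw [abs_mul, sq]; gcongr
  have hinv : |N⁻¹ - (1 - ρ * p)| ≤ 2 * ε^2 := by
    have : N⁻¹ - (1 - ρ * p) = (1 + ρ * p - N + ρ * p * (N - 1)) / N := by
      field_simp; ring
    rw [this, abs_div, abs_of_pos hN0, div_le_iff₀ hN0]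
    refine (abs_add_le _ _).trans ?_
    nlinarith [sq_nonneg ε]
  have hsr : |s + ρ * r| ≤ 5/4 := (abs_add_le _ _).trans (by linarith)
  have h1 : |(s + ρ * r) * (N⁻¹ - (1 - ρ * p))| ≤ 5/4 * (2 * ε^2) := by
    rw [abs_mul]; gcongr
  have h2 : |(ρ * r) * (ρ * p)| ≤ ε^2 := by
    rw [abs_mul, sq]; gcongr
  have h3 : (s + ρ * r) * N⁻¹ = s + ρ * (r - s * p) - (ρ * r) * (ρ * p)
      + (s + ρ * r) * (N⁻¹ - (1 - ρ * p)) := by ring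
  have h4 : 4 * B^2 * ρ^2 = 4 * ε^2 := by rw [hε]; ring
  rw [h3, h4]
  linarith [(abs_le.1 h1).1, (abs_le.1 h2).2, sq_nonneg ε]

lemma aux_v {H : Type*} [NormedAddCommGroup H] [InnerProductSpace ℝ H]
    (h m : H) (hh : ‖h‖ = 1) (hm : ‖m‖ = 1) : ‖⟪h, m⟫_ℝ • h - m‖ ≤ 1 := by
  have : ‖⟪h, m⟫_ℝ • h - m‖ ^ 2 = 1 - ⟪h, m⟫_ℝ ^ 2 := by
    rw [norm_sub_sq_real, norm_smul, real_inner_smul_left, hh, hm, Real.norm_eq_abs, mul_one,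
      sq_abs]; ring
  have h0 := norm_nonneg (⟪h, m⟫_ℝ • h - m)
  nlinarith [sq_nonneg ⟪h, m⟫_ℝ]

set_option maxHeartbeats 1000000 in
lemma aux_step {H : Type*} [NormedAddCommGroup H] [InnerProductSpace ℝ H]
    (h m m' ζ z : H) (A Cμ ρ η c : ℝ) (hA : 0 < A) (hCμ : 0 < Cμ) (hη : 0 < η)
    (hc0 : 0 < c) (hc1 : c ≤ 1/2) (hcA : 2 * c ≤ A)
    (hh : ‖h‖ = 1) (hm : ‖m‖ = 1) (hζ : ‖ζ‖ ≤ 2) (hρ : 0 < ρ)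
    (hρB : ρ * (A + 3) ≤ 1/4) (hd : ‖m' - m‖ ≤ Cμ * η)
    (hz : z = (1 - ρ) • h + ρ • (A • m + ζ)) :
    3/4 ≤ ‖z‖ ∧ (0 ≤ ⟪h, m⟫_ℝ → 
    ‖‖z‖⁻¹ • z - m'‖ ^ 2 ≤ (1 - c * ρ) * ‖h - m‖ ^ 2 
      + 2 * ρ * ⟪⟪h, m⟫_ℝ • h - m, ζ⟫_ℝ + (16 * (A+3)^2 + 4) * ρ^2 + (2 * Cμ^2 / c) * (η^2 / ρ)) := by
  have hρ1 : ρ ≤ 1 := by nlinarith [mul_pos hρ hA]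
  have hcρ : 0 < c * ρ := by positivity
  have hcρ1 : c * ρ ≤ 1 := by nlinarith
  have hz' : z = h + ρ • (A • m + ζ - h) := by rw [hz]; module
  have hwb : ‖A • m + ζ - h‖ ≤ A + 3 := by
    refine (norm_sub_le _ _).trans ?_
    have := norm_add_le (A • m) ζ
    rw [norm_smul, hm, Real.norm_eq_abs, abs_of_pos hA] at this
    rw [hh]; linarith
  obtain ⟨k1, k2⟩ := aux_proj h m (A • m + ζ - h) ρ (A+3) hh hm hwb hρ hρB
  rw [← hz'] at k1 k2
  refine ⟨k1, fun hs => ?_⟩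
  have hzn : ‖‖z‖⁻¹ • z‖ = 1 := by
    rw [norm_smul, norm_inv, norm_norm, inv_mul_cancel₀]; linarith
  set g := ‖z‖⁻¹ • z with hg
  have hξ : |⟪⟪h, m⟫_ℝ • h - m, ζ⟫_ℝ| ≤ 2 := by
    refine (abs_real_inner_le_norm _ _).trans ?_
    have := aux_v h m hh hm
    nlinarith [norm_nonneg ζ, norm_nonneg (⟪h, m⟫_ℝ • h - m)]
  have e0 : ‖h - m‖^2 = 2 - 2 * ⟪h, m⟫_ℝ := by rw [norm_sub_sq_real, hh, hm]; ring
  have e1 : ‖g - m‖^2 = 2 - 2 * ⟪g, m⟫_ℝ := by rw [norm_sub_sq_real, hzn, hm]; ring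
  have e2 : ⟪A • m + ζ - h, m⟫_ℝ - ⟪h, m⟫_ℝ * ⟪A • m + ζ - h, h⟫_ℝ
      = A * (1 - ⟪h, m⟫_ℝ^2) - ⟪⟪h, m⟫_ℝ • h - m, ζ⟫_ℝ := by
    simp only [inner_sub_left, inner_add_left, real_inner_smul_left, real_inner_self_eq_norm_sq,
      hh, hm, real_inner_comm h m, real_inner_comm ζ m, real_inner_comm ζ h]
    ring_nf
  rw [e2] at k2
  have hs1 : ⟪h, m⟫_ℝ ≤ 1 := by simpa [hh, hm] using real_inner_le_norm h m
  have e3 : ‖g - m‖^2 ≤ (1 - 2 * c * ρ) * ‖h - m‖^2 + 2 * ρ * ⟪⟪h, m⟫_ℝ • h - m, ζ⟫_ℝ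
      + 8 * (A+3)^2 * ρ^2 := by
    rw [e1, e0]
    generalize ⟪h, m⟫_ℝ = s at *
    have a1 : 1 - s ≤ 1 - s^2 := by nlinarith
    have a2 : 2 * c * (1 - s) ≤ A * (1 - s^2) := by
      apply mul_le_mul hcA a1 (by linarith) hA.le
    have a3 := mul_le_mul_of_nonneg_left a2 hρ.le
    nlinarith
  have e4 : ‖g - m'‖^2 ≤ (1 + c * ρ) * ‖g - m‖^2 + (2 * Cμ^2 / c) * (η^2 / ρ) := by
    have b1 : ‖g - m'‖ ≤ ‖g - m‖ + Cμ * η := by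
      have : g - m' = (g - m) - (m' - m) := by abel
      rw [this]
      exact (norm_sub_le _ _).trans (by linarith)
    have b2 : ‖g - m'‖^2 ≤ (‖g - m‖ + Cμ * η)^2 := by gcongr
    refine b2.trans ?_
    have b3 : (2 * Cμ^2 / c) * (η^2 / ρ) = 2 * (Cμ * η)^2 / (c * ρ) := by field_simp
    rw [b3]
    generalize ‖g - m‖ = x
    generalize Cμ * η = y
    generalize c * ρ = k at *
    have b4 : 2 * x * y ≤ k * x^2 + y^2 / k := by
      have : k * x^2 + y^2 / k - 2 * x * y = (k * x - y)^2 / k := by field_simp; ring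
      have : 0 ≤ (k * x - y)^2 / k := by positivity
      linarith
    have b5 : y^2 ≤ y^2 / k := by
      rw [le_div_iff₀ hcρ]; nlinarith [sq_nonneg y]
    have b6 : 2 * y^2 / k = y^2 / k + y^2 / k := by ring
    have b7 : (x + y)^2 = x^2 + 2 * x * y + y^2 := by ring
    have b8 : (1 + k) * x^2 = x^2 + k * x^2 := by ring
    linarith
  refine e4.trans ?_
  have e5 := mul_le_mul_of_nonneg_left e3 (by linarith : 0 ≤ 1 + c * ρ)
  have e6 : (1 + c * ρ) * (1 - 2 * c * ρ) * ‖h - m‖^2 ≤ (1 - c * ρ) * ‖h - m‖^2 := by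
    gcongr; nlinarith
  have e7 : c * ρ * (2 * ρ * ⟪⟪h, m⟫_ℝ • h - m, ζ⟫_ℝ) ≤ 4 * ρ^2 := by
    have := (abs_le.1 hξ).2
    have : c * (2 * ⟪⟪h, m⟫_ℝ • h - m, ζ⟫_ℝ) ≤ 4 := by nlinarith
    nlinarith [sq_nonneg ρ]
  have e8 : (1 + c * ρ) * (8 * (A+3)^2 * ρ^2) ≤ 16 * (A+3)^2 * ρ^2 := by
    have : 0 ≤ 8 * (A+3)^2 * ρ^2 := by positivity
    nlinarith
  have e9 : (1 + c * ρ) * ((1 - 2 * c * ρ) * ‖h - m‖^2 + 2 * ρ * ⟪⟪h, m⟫_ℝ • h - m, ζ⟫_ℝ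
      + 8 * (A+3)^2 * ρ^2) = (1 + c * ρ) * (1 - 2 * c * ρ) * ‖h - m‖^2
      + 2 * ρ * ⟪⟪h, m⟫_ℝ • h - m, ζ⟫_ℝ + c * ρ * (2 * ρ * ⟪⟪h, m⟫_ℝ • h - m, ζ⟫_ℝ)
      + (1 + c * ρ) * (8 * (A+3)^2 * ρ^2) := by ring
  have e10 : (16 * (A+3)^2 + 4) * ρ^2 = 16 * (A+3)^2 * ρ^2 + 4 * ρ^2 := by ring
  linarith

lemma aux_rec (e x : ℕ → ℝ) (r ρ c k Q M : ℝ) (T : ℕ) (hr : r = 1 - c * ρ) (hr0 : 0 ≤ r)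
    (hcρ : 0 < c * ρ) (he0 : 0 ≤ e 0)
    (hstep : ∀ t, e t ≤ 1/16 → e (t+1) ≤ r * e t + 2 * ρ * x t + k) (hk : 0 ≤ k)
    (hN : ∀ n ≤ T, ρ * ∑ j ∈ Finset.range n, r^(n-1-j) * x j ≤ Q)
    (hM : 2 * Q + k / (c * ρ) ≤ M) (hM0 : e 0 + M ≤ 1/16) :
    ∀ t ≤ T, e t ≤ r^t * e 0 + M ∧ e t ≤ 1/16 := by
  have key : ∀ t ≤ T, e t ≤ r^t * e 0
      + 2 * (ρ * ∑ j ∈ Finset.range t, r^(t-1-j) * x j) + k / (c * ρ) → 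
      e t ≤ r^t * e 0 + M ∧ e t ≤ 1/16 := by
    intro t ht h
    have h1 := hN t ht
    have h2 : r^t * e 0 ≤ e 0 := by
      have : r^t ≤ 1 := pow_le_one₀ hr0 (by linarith)
      nlinarith
    constructor <;> linarith
  have main : ∀ t ≤ T, e t ≤ r^t * e 0
      + 2 * (ρ * ∑ j ∈ Finset.range t, r^(t-1-j) * x j) + k / (c * ρ) := by
    intro t
    induction t with
    | zero => 
      intro _
      have : 0 ≤ k / (c * ρ) := by positivity
      simpa using this
    | succ t ih =>
      intro ht
      have i1 := ih (by omega)
      have i2 := hstep t (key t (by omega) i1).2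
      have hs : ∑ j ∈ Finset.range (t+1), r^(t+1-1-j) * x j
          = r * (∑ j ∈ Finset.range t, r^(t-1-j) * x j) + x t := by
        rw [Finset.sum_range_succ, Finset.mul_sum]
        congr 1
        · apply Finset.sum_congr rfl
          intro j hj
          rw [Finset.mem_range] at hj
          have : t + 1 - 1 - j = (t - 1 - j) + 1 := by omega
          rw [this, pow_succ]; ring
        · simp
      rw [hs]
      have i3 := mul_le_mul_of_nonneg_left i1 hr0
      have i4 : r * (k / (c * ρ)) + k = k / (c * ρ) := by
        have := div_mul_cancel₀ k hcρ.ne'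
        rw [hr]; linear_combination -this
      rw [pow_succ]
      generalize ∑ j ∈ Finset.range t, r^(t-1-j) * x j = N at *
      generalize k / (c * ρ) = k' at *
      linarith
  exact fun t ht => key t ht (main t ht)

lemma aux_tail {Ω : Type*} {m0 : MeasurableSpace Ω}
    (P : Measure Ω) [IsProbabilityMeasure P] (ℱ : Filtration ℕ m0)
    {H : Type*} [NormedAddCommGroup H] [InnerProductSpace ℝ H] [CompleteSpace H]
    (ζ v : ℕ → Ω → H)
    (hζ : ∀ t, StronglyMeasurable[ℱ (t + 1)] (ζ t))
    (hint : ∀ t, Integrable (ζ t) P)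
    (hc : ∀ t, P[ζ t | ℱ t] =ᵐ[P] 0)
    (hζb : ∀ t, ∀ᵐ ω ∂P, ‖ζ t ω‖ ≤ 2)
    (hv : ∀ t, StronglyMeasurable[ℱ t] (v t))
    (hvb : ∀ t, ∀ᵐ ω ∂P, ‖v t ω‖ ≤ 1) (r ρ c L : ℝ) (hr : r = 1 - c * ρ) (hr0 : 0 ≤ r)
    (hρ : 0 < ρ) (hc0 : 0 < c) (hL : 0 < L) (hρL : ρ * L ≤ 1) (n : ℕ) :
    P.real {ω | 2 * (1 + 1/c) * Real.sqrt (ρ * L)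
      < ρ * ∑ j ∈ Finset.range n, r^(n-1-j) * ⟪v j ω, ζ j ω⟫_ℝ} ≤ Real.exp (-L) := by
  set S := Real.sqrt (ρ * L) with hS
  have hS2 : S^2 = ρ * L := Real.sq_sqrt (by positivity)
  have hS0 : 0 < S := Real.sqrt_pos.2 (by positivity)
  have hS1 : S ≤ 1 := by nlinarith
  have hr1 : r ≤ 1 := by rw [hr]; nlinarith [mul_pos hc0 hρ]
  have hp0 : ∀ j, 0 ≤ r^(n-1-j) := fun j => by positivity
  have hp1 : ∀ j, r^(n-1-j) ≤ 1 := fun j => pow_le_one₀ hr0 hr1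
  obtain ⟨_, _, h3, h4⟩ := aux_mgf P ℱ ζ (fun j ω => (S/2 * r^(n-1-j)) • v j ω)
    (fun j => S/2 * r^(n-1-j)) hζ hint hc hζb (fun t => (hv t).const_smul _)
    (fun t => by
      filter_upwards [hvb t] with ω h
      have : 0 ≤ S/2 * r^(n-1-t) := mul_nonneg (by positivity) (hp0 t)
      rw [norm_smul, Real.norm_eq_abs, abs_of_nonneg this]
      nlinarith)
    (fun t => by nlinarith [hp0 t, hp1 t]) n
  have hsum : ∀ ω, ∑ j ∈ Finset.range n, ⟪(S/2 * r^(n-1-j)) • v j ω, ζ j ω⟫_ℝ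
      = S/2 * ∑ j ∈ Finset.range n, r^(n-1-j) * ⟪v j ω, ζ j ω⟫_ℝ := by
    intro ω
    rw [Finset.mul_sum]
    exact Finset.sum_congr rfl fun j _ => by rw [real_inner_smul_left]; ring
  have hgeo : ∑ j ∈ Finset.range n, r^(n-1-j) ≤ 1 / (c * ρ) := by
    rw [Finset.sum_range_reflect (fun j => r^j) n, le_div_iff₀ (by positivity)]
    have := geom_sum_mul_neg r n
    have h1 : c * ρ = 1 - r := by rw [hr]; ring
    rw [h1, this]
    linarith [pow_nonneg hr0 n]
  have hvar : ∑ j ∈ Finset.range n, 4 * (S/2 * r^(n-1-j))^2 ≤ L / c := by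
    calc ∑ j ∈ Finset.range n, 4 * (S/2 * r^(n-1-j))^2
        ≤ ∑ j ∈ Finset.range n, (ρ * L) * r^(n-1-j) := by
          apply Finset.sum_le_sum
          intro j _
          have : 4 * (S/2 * r^(n-1-j))^2 = (ρ * L) * (r^(n-1-j))^2 := by rw [← hS2]; ring
          rw [this]
          have : (r^(n-1-j))^2 ≤ r^(n-1-j) := by nlinarith [hp0 j, hp1 j]
          gcongr
      _ = (ρ * L) * ∑ j ∈ Finset.range n, r^(n-1-j) := by rw [Finset.mul_sum]
      _ ≤ (ρ * L) * (1 / (c * ρ)) := by gcongr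
      _ = L / c := by field_simp
  have hcher := measure_ge_le_exp_mul_mgf (μ := P) (t := 1)
    (X := fun ω => ∑ j ∈ Finset.range n, ⟪(S/2 * r^(n-1-j)) • v j ω, ζ j ω⟫_ℝ)
    ((1 + 1/c) * L) zero_le_one (by simpa using h3)
  have hmgf : mgf (fun ω => ∑ j ∈ Finset.range n, ⟪(S/2 * r^(n-1-j)) • v j ω, ζ j ω⟫_ℝ) P 1
      ≤ Real.exp (L / c) := by
    simp only [mgf, one_mul]
    exact h4.trans (Real.exp_le_exp.2 hvar)
  calc _ ≤ P.real {ω | (1 + 1/c) * L ≤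
        ∑ j ∈ Finset.range n, ⟪(S/2 * r^(n-1-j)) • v j ω, ζ j ω⟫_ℝ} := by
        apply measureReal_mono _ (measure_ne_top _ _)
        intro ω hω
        simp only [Set.mem_setOf_eq] at hω ⊢
        rw [hsum]
        generalize ∑ j ∈ Finset.range n, r^(n-1-j) * ⟪v j ω, ζ j ω⟫_ℝ = N at *
        have : ρ * ((1 + 1/c) * L) ≤ ρ * (S/2 * N) := by
          have h1 : ρ * ((1 + 1/c) * L) = S/2 * (2 * (1 + 1/c) * S) := by
            linear_combination -(1 + 1/c) * hS2
          have h2 : ρ * (S/2 * N) = S/2 * (ρ * N) := by ring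
          rw [h1, h2]
          gcongr
        exact le_of_mul_le_mul_left this hρ
    _ ≤ _ := hcher
    _ ≤ Real.exp (-1 * ((1 + 1/c) * L)) * Real.exp (L / c) := by gcongr
    _ = _ := by rw [← Real.exp_add]; congr 1; ring

/-- Local mean-direction tracking: the EMA-with-projection fast process `μ̂_t` tracks a
slowly drifting unit-norm target `μ_t` from noisy observations `A·μ_t + ζ_{t+1}`.
Here `ζ t` plays the role of `ζ_{t+1}` in the paper (it is `ℱ (t+1)`-measurable). -/
theorem stmt9 {Ω : Type*} {m0 : MeasurableSpace Ω}
    (P : Measure Ω) [IsProbabilityMeasure P] (ℱ : Filtration ℕ m0)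
    {H : Type*} [NormedAddCommGroup H] [InnerProductSpace ℝ H] [CompleteSpace H]
    (A Cμ : ℝ) (hA : 0 < A) (hCμ : 0 < Cμ) :
    ∃ c ∈ Set.Ioo (0:ℝ) 1, ∃ C > (0:ℝ), ∃ ρ0 ∈ Set.Ioo (0:ℝ) 1, ∃ γ0 > (0:ℝ),
      ∀ T : ℕ, 1 ≤ T → ∀ δ ∈ Set.Ioo (0:ℝ) 1, ∀ ρ ∈ Set.Ioc (0:ℝ) ρ0,
        ρ * Real.log (2 * (T:ℝ) / δ) ≤ 1 →
      ∀ η : ℝ, 0 < η → η / ρ ≤ γ0 →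
      ∀ μ : ℕ → Ω → H,
        (∀ t, StronglyMeasurable[ℱ t] (μ t)) →
        (∀ t ω, ‖μ t ω‖ = 1) →
        (∀ t, ∀ᵐ ω ∂P, ‖μ (t + 1) ω - μ t ω‖ ≤ Cμ * η) →
      ∀ ζ : ℕ → Ω → H,
        (∀ t, StronglyMeasurable[ℱ (t + 1)] (ζ t)) →
        (∀ t, Integrable (ζ t) P) →
        (∀ t, P[ζ t | ℱ t] =ᵐ[P] 0) →
        (∀ t, ∀ᵐ ω ∂P, ‖ζ t ω‖ ≤ 2) →
      ∀ μhat z : ℕ → Ω → H,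
        StronglyMeasurable[ℱ 0] (μhat 0) →
        (∀ ω, ‖μhat 0 ω‖ = 1) →
        (∀ᵐ ω ∂P, ‖μhat 0 ω - μ 0 ω‖ ≤ 1 / 4) →
        (∀ᵐ ω ∂P, ‖μhat 0 ω - μ 0 ω‖ ^ 2
            + C * (Real.sqrt (ρ * Real.log (2 * (T:ℝ) / δ)) + η ^ 2 / ρ ^ 2) ≤ 1 / 16) →
        (∀ t ω, z (t + 1) ω = (1 - ρ) • μhat t ω + ρ • (A • μ t ω + ζ t ω)) →
        (∀ t ω, μhat (t + 1) ω = (‖z (t + 1) ω‖⁻¹) • z (t + 1) ω) →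
        (1:ℝ) - δ ≤ (P {ω |
            (∀ t ≤ T, ‖μhat t ω - μ t ω‖ ^ 2 ≤ (1 - c * ρ) ^ t * ‖μhat 0 ω - μ 0 ω‖ ^ 2
              + C * (Real.sqrt (ρ * Real.log (2 * (T:ℝ) / δ)) + η ^ 2 / ρ ^ 2)) ∧
            (∀ t ≤ T, ‖μhat t ω - μ t ω‖ ≤ 1 / 4 ∧ 0 < ⟪μhat t ω, μ t ω⟫_ℝ) ∧
            (∀ t ≤ T - 1, 1 / 4 ≤ ‖z (t + 1) ω‖)}).toReal := by
  obtain ⟨c, hc0, hc1, hcA⟩ : ∃ c : ℝ, 0 < c ∧ c ≤ 1/2 ∧ 2 * c ≤ A :=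
    ⟨min (A/2) (1/2), by positivity, min_le_right _ _, by linarith [min_le_left (A/2) (1/2)]⟩
  have hρ0 : 0 < 1 / (4 * (A + 3)) := by positivity
  refine ⟨c, ⟨hc0, by linarith⟩,
    4 * (1 + 1/c) + 2 * (16 * (A+3)^2 + 4) / c + (2 * Cμ^2 / c) / c, by positivity,
    1 / (4 * (A + 3)), ⟨hρ0, ?_⟩, 1, one_pos, ?_⟩
  · rw [div_lt_one (by positivity)]; linarith
  intro T hT δ hδ ρ hρ hρL η hη _ μ hμm hμ1 hμd ζ hζm hζi hζc hζb μhat z h0m h01 _ h0b hz hhat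
  obtain ⟨hρ, hρle⟩ := hρ
  obtain ⟨hδ0, hδ1⟩ := hδ
  have hρB : ρ * (A + 3) ≤ 1/4 := by
    rw [le_div_iff₀ (by positivity)] at hρle; linarith
  have hρ1 : ρ ≤ 1 := by nlinarith [mul_pos hρ hA]
  have hcρ : 0 < c * ρ := by positivity
  have hcρ1 : c * ρ ≤ 1 := by nlinarith
  have hT' : (1:ℝ) ≤ T := by exact_mod_cast hT
  have hL : 1/2 ≤ Real.log (2 * (T:ℝ) / δ) := by
    have h1 : (2:ℝ) ≤ 2 * (T:ℝ) / δ := by rw [le_div_iff₀ hδ0]; nlinarith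
    have h2 := Real.log_le_log (by norm_num) h1
    linarith [Real.log_two_gt_d9]
  have hexp : Real.exp (-Real.log (2 * (T:ℝ) / δ)) = δ / (2 * T) := by
    rw [Real.exp_neg, Real.exp_log (by positivity), inv_div]
  generalize Real.log (2 * (T:ℝ) / δ) = L at *
  have hL0 : 0 < L := by linarith
  set r := 1 - c * ρ with hr
  have hr0 : 0 ≤ r := by linarith
  set S := Real.sqrt (ρ * L) with hS
  have hρS : ρ ≤ 2 * S := by
    have : S^2 = ρ * L := Real.sq_sqrt (by positivity)
    have hS0 : 0 ≤ S := Real.sqrt_nonneg _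
    by_contra! hcon
    nlinarith
  set v : ℕ → Ω → H := fun t ω => ⟪μhat t ω, μ t ω⟫_ℝ • μhat t ω - μ t ω with hv
  have hhm : ∀ t, StronglyMeasurable[ℱ t] (μhat t) := by
    intro t
    induction t with
    | zero => exact h0m
    | succ t ih =>
      have hle := ℱ.mono (Nat.le_succ t)
      have hzm : StronglyMeasurable[ℱ (t+1)] (z (t+1)) := by
        have : z (t+1) = fun ω => (1 - ρ) • μhat t ω + ρ • (A • μ t ω + ζ t ω) :=
          funext (hz t)
        rw [this]
        exact ((ih.mono hle).const_smul _).add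
          (((((hμm t).mono hle).const_smul A).add (hζm t)).const_smul ρ)
      have : μhat (t+1) = fun ω => (‖z (t + 1) ω‖⁻¹) • z (t + 1) ω := funext (hhat t)
      rw [this]
      exact (hzm.norm.measurable.inv.stronglyMeasurable).smul hzm
  have hvm : ∀ t, StronglyMeasurable[ℱ t] (v t) := fun t =>
    (((hhm t).inner (hμm t)).smul (hhm t)).sub (hμm t)
  have hgood : ∀ᵐ ω ∂P, ∀ t, ‖μhat t ω‖ = 1 := by
    filter_upwards [ae_all_iff.2 hζb, ae_all_iff.2 hμd] with ω h1 h2 t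
    induction t with
    | zero => exact h01 ω
    | succ t ih =>
      have := (aux_step _ _ _ _ _ A Cμ ρ η c hA hCμ hη hc0 hc1 hcA ih (hμ1 t ω) (h1 t) hρ hρB
        (h2 t) (hz t ω)).1
      rw [hhat, norm_smul, norm_inv, norm_norm, inv_mul_cancel₀]; linarith
  have hvb : ∀ t, ∀ᵐ ω ∂P, ‖v t ω‖ ≤ 1 := by
    intro t
    filter_upwards [hgood] with ω h
    exact aux_v _ _ (h t) (hμ1 t ω)
  set bad : ℕ → Set Ω := fun n => {ω | 2 * (1 + 1/c) * S
      < ρ * ∑ j ∈ Finset.range n, r^(n-1-j) * ⟪v j ω, ζ j ω⟫_ℝ} with hbad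
  have htail : ∀ n, P.real (bad n) ≤ δ / (2 * T) := fun n => by
    rw [← hexp]
    exact aux_tail P ℱ ζ v hζm hζi hζc hζb hvm hvb r ρ c L hr hr0 hρ hc0 hL0 hρL n
  have hunion : P.real (⋃ n ∈ Finset.range (T+1), bad n) ≤ δ := by
    refine (measureReal_biUnion_finset_le _ _).trans ?_
    refine (Finset.sum_le_sum fun n _ => htail n).trans ?_
    rw [Finset.sum_const, Finset.card_range, nsmul_eq_mul]
    push_cast
    rw [mul_div_assoc', div_le_iff₀ (by positivity)]
    nlinarith
  set E : Set Ω := {ω | _} with hE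
  change 1 - δ ≤ P.real E
  have hsub : (Eᶜ : Set Ω) ≤ᵐ[P] (⋃ n ∈ Finset.range (T+1), bad n : Set Ω) := by
    filter_upwards [ae_all_iff.2 hζb, ae_all_iff.2 hμd, hgood, h0b] with ω h1 h2 h3 h4 h5
    by_contra hnb
    apply h5
    have hnb' : ∀ n ≤ T, ρ * ∑ j ∈ Finset.range n, r^(n-1-j) * ⟪v j ω, ζ j ω⟫_ℝ
        ≤ 2 * (1 + 1/c) * S := by
      intro n hn
      by_contra! hcon
      apply hnb
      exact Set.mem_biUnion (Finset.mem_coe.2 (Finset.mem_range.2 (Nat.lt_succ_of_le hn))) hcon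
    have hst := fun t => aux_step _ _ _ _ _ A Cμ ρ η c hA hCμ hη hc0 hc1 hcA (h3 t) (hμ1 t ω)
      (h1 t) hρ hρB (h2 t) (hz t ω)
    have hinn : ∀ t, ‖μhat t ω - μ t ω‖^2 ≤ 1/16 → 0 < ⟪μhat t ω, μ t ω⟫_ℝ := by
      intro t h
      rw [norm_sub_sq_real, h3 t, hμ1] at h
      linarith
    have hrec := aux_rec (fun t => ‖μhat t ω - μ t ω‖^2) (fun t => ⟪v t ω, ζ t ω⟫_ℝ) r ρ c
      ((16 * (A+3)^2 + 4) * ρ^2 + (2 * Cμ^2 / c) * (η^2 / ρ)) (2 * (1 + 1/c) * S)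
      ((4 * (1 + 1/c) + 2 * (16 * (A+3)^2 + 4) / c + (2 * Cμ^2 / c) / c)
        * (S + η ^ 2 / ρ ^ 2)) T hr hr0 hcρ (by positivity)
      (fun t ht => by
        have := (hst t).2 (hinn t ht).le
        rw [← hhat] at this
        simp only [hv]
        linarith) (by positivity) hnb' ?_ h4
    · refine ⟨fun t ht => (hrec t ht).1, fun t ht => ⟨?_, hinn t (hrec t ht).2⟩,
        fun t _ => by linarith [(hst t).1]⟩
      have := (hrec t ht).2
      exact abs_le_of_sq_le_sq' (by linarith) (by norm_num) |>.2
    · have hS0 : 0 ≤ S := Real.sqrt_nonneg _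
      have hη2 : 0 ≤ η^2 / ρ^2 := by positivity
      have q1 : ((16 * (A+3)^2 + 4) * ρ^2 + (2 * Cμ^2 / c) * (η^2 / ρ)) / (c * ρ)
          = (16 * (A+3)^2 + 4) / c * ρ + (2 * Cμ^2 / c) / c * (η^2 / ρ^2) := by
        field_simp
      rw [q1]
      have k1 : 0 ≤ (16 * (A+3)^2 + 4) / c := by positivity
      have k2 : 0 ≤ (2 * Cμ^2 / c) / c := by positivity
      have k3 : 0 ≤ 1 + 1/c := by positivity
      have k4 : 2 * (16 * (A+3)^2 + 4) / c = 2 * ((16 * (A+3)^2 + 4) / c) := by ring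
      rw [k4]
      generalize (16 * (A+3)^2 + 4) / c = a at *
      generalize (2 * Cμ^2 / c) / c = b at *
      generalize 1 + 1/c = d at *
      generalize η^2 / ρ^2 = y at *
      have p1 := mul_le_mul_of_nonneg_left hρS k1
      have p2 := mul_nonneg k3 hη2
      have p3 := mul_nonneg k1 hη2
      have p4 := mul_nonneg k2 hS0
      linarith
  have hcompl : P.real Eᶜ ≤ δ := by
    refine le_trans ?_ hunion
    exact ENNReal.toReal_mono (measure_ne_top _ _) (measure_mono_ae hsub)
  have hone : (1:ℝ) ≤ P.real E + P.real Eᶜ := by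
    have := measureReal_union_le (μ := P) E Eᶜ
    rwa [Set.union_compl_self, probReal_univ] at this
  linarith
end
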